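/- The constrained joint spectral radius ρ̂(G, M) equals the infimum over all γ > 0 such that the system S(G, M) admits a γ-multinorm. -/

import Mathlib

open Filter Matrix

/-- The operator norm on `n × n` real matrices induced by the Euclidean norm on `ℝ^n`. -/
noncomputable def euclOpNorm {n : ℕ} (A : Matrix (Fin n) (Fin n) ℝ) : ℝ :=
  ‖LinearMap.toContinuousLinearMap (Matrix.toEuclideanLin A)‖

/-- The Euclidean norm on `ℝ^n`. -/
noncomputable def euclNorm {n : ℕ} (x : Fin n → ℝ) : ℝ :=
  Real.sqrt (∑ i, x i ^ 2)

/-- The matrix product `A_{σ(t-1)} ⋯ A_{σ(0)}` associated to a sequence of labels `σ`. -/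
noncomputable def pathProd {n N : ℕ} (A : Fin N → Matrix (Fin n) (Fin n) ℝ)
    (t : ℕ) (σ : Fin t → Fin N) : Matrix (Fin n) (Fin n) ℝ :=
  (List.ofFn fun i => A (σ i)).reverse.prod

/-- `v, σ` describe a path of length `t` in the labeled graph with edge set `E`:
its `i`-th edge goes from node `v i` to node `v (i+1)` and carries the label `σ i`. -/
def IsPath {V : Type*} {N : ℕ} (E : Set (V × V × Fin N)) {t : ℕ}
    (v : Fin (t + 1) → V) (σ : Fin t → Fin N) : Prop :=
  ∀ i : Fin t, (v i.castSucc, v i.succ, σ i) ∈ E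

/-- The labeled graph with edge set `E` is strongly connected: any node can be joined to
any node by a path of length at least 1. -/
def StronglyConnected {V : Type*} {N : ℕ} (E : Set (V × V × Fin N)) : Prop :=
  ∀ u w : V, ∃ (t : ℕ) (v : Fin (t + 1) → V) (σ : Fin t → Fin N),
    1 ≤ t ∧ IsPath E v σ ∧ v 0 = u ∧ v (Fin.last t) = w

/-- The constrained joint spectral radius of the system `S(G, M)` with `G = (V, E)`, `M = A`. -/
noncomputable def cjsr {V : Type*} {n N : ℕ} (E : Set (V × V × Fin N))
    (A : Fin N → Matrix (Fin n) (Fin n) ℝ) : ℝ :=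
  Filter.atTop.limsup fun t : ℕ =>
    sSup { x : ℝ | ∃ (v : Fin (t + 1) → V) (σ : Fin t → Fin N),
      IsPath E v σ ∧ x = euclOpNorm (pathProd A t σ) ^ (1 / (t : ℝ)) }

/-- The constrained joint spectral radius of the `T`-lifted system `S(G_T, M^T)`:
paths of length `k` in `G_T` are exactly paths of length `k * T` in `G`. -/
noncomputable def cjsrLift {V : Type*} {n N : ℕ} (E : Set (V × V × Fin N))
    (A : Fin N → Matrix (Fin n) (Fin n) ℝ) (T : ℕ) : ℝ :=
  Filter.atTop.limsup fun k : ℕ =>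
    sSup { x : ℝ | ∃ (v : Fin (k * T + 1) → V) (σ : Fin (k * T) → Fin N),
      IsPath E v σ ∧ x = euclOpNorm (pathProd A (k * T) σ) ^ (1 / (k : ℝ)) }

/-- Stability of the constrained switching system: along every infinite path of the graph,
every trajectory converges to `0`. -/
def Stable {V : Type*} {n N : ℕ} (E : Set (V × V × Fin N))
    (A : Fin N → Matrix (Fin n) (Fin n) ℝ) : Prop :=
  ∀ (v : ℕ → V) (σ : ℕ → Fin N), (∀ t : ℕ, (v t, v (t + 1), σ t) ∈ E) →
    ∀ x0 : Fin n → ℝ,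
      Tendsto (fun t : ℕ => (pathProd A t fun i : Fin t => σ i).mulVec x0)
        atTop (nhds 0)

/-- `ν` is a family of norms on `ℝ^n` indexed by the nodes. -/
def IsNormFamily {V : Type*} {n : ℕ} (ν : V → (Fin n → ℝ) → ℝ) : Prop :=
  ∀ u : V,
    (∀ x y : Fin n → ℝ, ν u (x + y) ≤ ν u x + ν u y) ∧
    (∀ (a : ℝ) (x : Fin n → ℝ), ν u (a • x) = |a| * ν u x) ∧
    (∀ x : Fin n → ℝ, ν u x = 0 → x = 0)

/-- `ν` is a `γ`-multinorm for the system `S(G, M)`. -/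
def IsMultinorm {V : Type*} {n N : ℕ} (E : Set (V × V × Fin N))
    (A : Fin N → Matrix (Fin n) (Fin n) ℝ) (γ : ℝ)
    (ν : V → (Fin n → ℝ) → ℝ) : Prop :=
  IsNormFamily ν ∧
    ∀ vi vj : V, ∀ σ : Fin N, (vi, vj, σ) ∈ E →
      ∀ x : Fin n → ℝ, ν vj ((A σ).mulVec x) ≤ γ * ν vi x

/-- `Q` is a quadratic `γ`-multinorm for the system `S(G, M)`. -/
def IsQuadMultinorm {V : Type*} {n N : ℕ} (E : Set (V × V × Fin N))
    (A : Fin N → Matrix (Fin n) (Fin n) ℝ) (γ : ℝ)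
    (Q : V → Matrix (Fin n) (Fin n) ℝ) : Prop :=
  (∀ u : V, (Q u).PosDef) ∧
    ∀ vi vj : V, ∀ σ : Fin N, (vi, vj, σ) ∈ E →
      (γ ^ 2 • Q vi - (A σ)ᵀ * Q vj * A σ).PosSemidef

/-- `Q` is a quadratic `γ`-multinorm for the lifted system `S(G_T, M^T)`: the Loewner
inequality holds along every path of length `T` of `G` (i.e. every edge of `G_T`). -/
def IsQuadMultinormLift {V : Type*} {n N : ℕ} (E : Set (V × V × Fin N))
    (A : Fin N → Matrix (Fin n) (Fin n) ℝ) (T : ℕ) (γ : ℝ)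
    (Q : V → Matrix (Fin n) (Fin n) ℝ) : Prop :=
  (∀ u : V, (Q u).PosDef) ∧
    ∀ (v : Fin (T + 1) → V) (σ : Fin T → Fin N), IsPath E v σ →
      (γ ^ 2 • Q (v 0) -
        (pathProd A T σ)ᵀ * Q (v (Fin.last T)) * pathProd A T σ).PosSemidef

/-- `Q` is a path-dependent Lyapunov function with memory `T` for `S(G, M)`:
one positive definite quadratic form per path of length `T`, with a strict decrease
condition along every path of length `T + 1`. -/
def IsPathDepLyap {V : Type*} {n N : ℕ} (E : Set (V × V × Fin N))
    (A : Fin N → Matrix (Fin n) (Fin n) ℝ) (T : ℕ)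
    (Q : (Fin (T + 1) → V) → (Fin T → Fin N) → Matrix (Fin n) (Fin n) ℝ) : Prop :=
  (∀ (v : Fin (T + 1) → V) (σ : Fin T → Fin N), IsPath E v σ → (Q v σ).PosDef) ∧
    ∀ (v : Fin (T + 2) → V) (σ : Fin (T + 1) → Fin N), IsPath E v σ →
      (Q (fun i : Fin (T + 1) => v i.castSucc) (fun i : Fin T => σ i.castSucc) -
        (A (σ (Fin.last T)))ᵀ *
          Q (fun i : Fin (T + 1) => v i.succ) (fun i : Fin T => σ i.succ) *
            A (σ (Fin.last T))).PosDef

/-- The joint spectral radius of a finite set of matrices (arbitrary switching). -/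
noncomputable def jsr {n N : ℕ} (A : Fin N → Matrix (Fin n) (Fin n) ℝ) : ℝ :=
  Filter.atTop.limsup fun t : ℕ =>
    sSup { x : ℝ | ∃ σ : Fin t → Fin N,
      x = euclOpNorm (pathProd A t σ) ^ (1 / (t : ℝ)) }

/-- The joint spectral radius of the set `M^T` of all products of `T` matrices from `M`:
products of `k` matrices from `M^T` are exactly products of `k * T` matrices from `M`. -/
noncomputable def jsrPow {n N : ℕ} (A : Fin N → Matrix (Fin n) (Fin n) ℝ) (T : ℕ) : ℝ :=
  Filter.atTop.limsup fun k : ℕ =>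
    sSup { x : ℝ | ∃ σ : Fin (k * T) → Fin N,
      x = euclOpNorm (pathProd A (k * T) σ) ^ (1 / (k : ℝ)) }

/-- The optimal value `γ*(G, M)` of the semidefinite program of Corollary 4.6. -/
noncomputable def gammaStar {V : Type*} {n N : ℕ} (E : Set (V × V × Fin N))
    (A : Fin N → Matrix (Fin n) (Fin n) ℝ) : ℝ :=
  sInf {γ : ℝ | 0 < γ ∧ ∃ Q : V → Matrix (Fin n) (Fin n) ℝ,
    (∀ u : V, (Q u).PosDef) ∧ ∀ vi vj : V, ∀ σ : Fin N, (vi, vj, σ) ∈ E →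
      (γ ^ 2 • Q vi - (A σ)ᵀ * Q vj * A σ).PosDef}

/-- The optimal value `γ*(G_T, M^T)` of the semidefinite program applied to the lifted
system `S(G_T, M^T)`. -/
noncomputable def gammaStarLift {V : Type*} {n N : ℕ} (E : Set (V × V × Fin N))
    (A : Fin N → Matrix (Fin n) (Fin n) ℝ) (T : ℕ) : ℝ :=
  sInf {γ : ℝ | 0 < γ ∧ ∃ Q : V → Matrix (Fin n) (Fin n) ℝ,
    (∀ u : V, (Q u).PosDef) ∧
      ∀ (v : Fin (T + 1) → V) (σ : Fin T → Fin N), IsPath E v σ →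
        (γ ^ 2 • Q (v 0) -
          (pathProd A T σ)ᵀ * Q (v (Fin.last T)) * pathProd A T σ).PosDef}

theorem cjsrAux_pathProd_succ {n N : ℕ} (A : Fin N → Matrix (Fin n) (Fin n) ℝ)
    (t : ℕ) (σ : Fin (t + 1) → Fin N) :
    pathProd A (t + 1) σ = pathProd A t (fun i => σ i.succ) * A (σ 0) := by
  simp [pathProd, List.ofFn_succ]

/-- Auxiliary Euclidean norm. -/
noncomputable def cjsrAuxE {n : ℕ} (x : Fin n → ℝ) : ℝ := ‖WithLp.toLp 2 x‖

theorem cjsrAuxE_mulVec {n : ℕ} (M : Matrix (Fin n) (Fin n) ℝ) (x : Fin n → ℝ) :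
    cjsrAuxE (M.mulVec x) ≤ euclOpNorm M * cjsrAuxE x :=
  (LinearMap.toContinuousLinearMap (Matrix.toEuclideanLin M)).le_opNorm (WithLp.toLp 2 x)

theorem euclOpNorm_le_of {n : ℕ} (M : Matrix (Fin n) (Fin n) ℝ) (C : ℝ) (hC : 0 ≤ C)
    (h : ∀ x, cjsrAuxE (M.mulVec x) ≤ C * cjsrAuxE x) : euclOpNorm M ≤ C :=
  ContinuousLinearMap.opNorm_le_bound _ hC fun x => h (WithLp.ofLp x)

theorem euclOpNorm_nonneg' {n : ℕ} (M : Matrix (Fin n) (Fin n) ℝ) : 0 ≤ euclOpNorm M :=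
  norm_nonneg _

theorem cjsrAuxE_nonneg {n : ℕ} (x : Fin n → ℝ) : 0 ≤ cjsrAuxE x := norm_nonneg _

theorem cjsrAuxE_add {n : ℕ} (x y : Fin n → ℝ) :
    cjsrAuxE (x + y) ≤ cjsrAuxE x + cjsrAuxE y := by
  simpa [cjsrAuxE] using norm_add_le (WithLp.toLp 2 x) (WithLp.toLp 2 y)

theorem cjsrAuxE_smul {n : ℕ} (a : ℝ) (x : Fin n → ℝ) :
    cjsrAuxE (a • x) = |a| * cjsrAuxE x := by
  simp [cjsrAuxE, norm_smul]

theorem cjsrAuxE_eq_zero {n : ℕ} (x : Fin n → ℝ) (h : cjsrAuxE x = 0) : x = 0 := by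
  simpa [cjsrAuxE] using h

/-- A norm is equivalent to the Euclidean norm. -/
theorem cjsrAux_equiv {n : ℕ} (f : (Fin n → ℝ) → ℝ)
    (h1 : ∀ x y : Fin n → ℝ, f (x + y) ≤ f x + f y)
    (h2 : ∀ (a : ℝ) (x : Fin n → ℝ), f (a • x) = |a| * f x)
    (h3 : ∀ x : Fin n → ℝ, f x = 0 → x = 0) :
    ∃ C : ℝ, 0 < C ∧ ∀ x, f x ≤ C * cjsrAuxE x ∧ cjsrAuxE x ≤ C * f x := by
  let p : Seminorm ℝ (EuclideanSpace ℝ (Fin n)) :=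
    Seminorm.of (fun x => f (WithLp.ofLp x)) (fun x y => h1 _ _) (fun a x => h2 _ _)
  have hp : ∀ x, p x = f (WithLp.ofLp x) := fun x => rfl
  have hcont : Continuous p := by
    have hc : ConvexOn ℝ Set.univ p := p.convexOn
    exact continuousOn_univ.mp (hc.continuousOn isOpen_univ)
  have hup : ∃ C : ℝ, 0 < C ∧ ∀ x, p x ≤ C * ‖x‖ := p.bound_of_continuous_normedSpace hcont
  have hlow : ∃ c : ℝ, 0 < c ∧ ∀ x, ‖x‖ ≤ c * p x := by
    rcases (Metric.sphere (0 : EuclideanSpace ℝ (Fin n)) 1).eq_empty_or_nonempty with he | hne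
    · refine ⟨1, one_pos, fun x => ?_⟩
      have hx : x = 0 := by
        by_contra hx
        have : (‖x‖⁻¹ • x) ∈ Metric.sphere (0 : EuclideanSpace ℝ (Fin n)) 1 := by
          have : ‖x‖ ≠ 0 := norm_ne_zero_iff.mpr hx
          simp [norm_smul, this]
        rw [he] at this
        exact this
      simp [hx]
    · obtain ⟨y, hy, hmin⟩ := (isCompact_sphere (0 : EuclideanSpace ℝ (Fin n)) 1).exists_isMinOn
        hne hcont.continuousOn
      have hy1 : ‖y‖ = 1 := by simpa using hy
      have hpy : 0 < p y := by
        refine lt_of_le_of_ne (apply_nonneg p y) fun h => ?_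
        have h0 := h3 (WithLp.ofLp y) (by rw [← hp, ← h])
        have : y = 0 := by simpa using h0
        simp [this] at hy1
      refine ⟨(p y)⁻¹, inv_pos.mpr hpy, fun x => ?_⟩
      by_cases hx : x = 0
      · simp [hx]
      have hxn : 0 < ‖x‖ := norm_pos_iff.mpr hx
      have hm : (‖x‖⁻¹ • x) ∈ Metric.sphere (0 : EuclideanSpace ℝ (Fin n)) 1 := by
        simp [norm_smul, hxn.ne']
      have h := hmin hm
      simp only [Set.mem_ofPred_eq, map_smul_eq_mul, norm_inv, norm_norm] at h
      rw [inv_mul_eq_div, le_div_iff₀ hpy]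
      rw [inv_mul_eq_div, le_div_iff₀ hxn] at h
      linarith
  obtain ⟨C, hC, hC'⟩ := hup
  obtain ⟨c, hc, hc'⟩ := hlow
  refine ⟨max C c, lt_max_of_lt_left hC, fun x => ⟨?_, ?_⟩⟩
  · exact (hC' (WithLp.toLp 2 x)).trans
      (mul_le_mul_of_nonneg_right (le_max_left _ _) (norm_nonneg _))
  · exact (hc' (WithLp.toLp 2 x)).trans
      (mul_le_mul_of_nonneg_right (le_max_right _ _) (apply_nonneg p _))

theorem cjsrAux_path_le {V : Type} {n N : ℕ} {E : Set (V × V × Fin N)}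
    {A : Fin N → Matrix (Fin n) (Fin n) ℝ} {γ : ℝ} (hγ : 0 < γ)
    {ν : V → (Fin n → ℝ) → ℝ} (hν : IsMultinorm E A γ ν) :
    ∀ (t : ℕ) (v : Fin (t + 1) → V) (σ : Fin t → Fin N), IsPath E v σ → ∀ x,
      ν (v (Fin.last t)) ((pathProd A t σ).mulVec x) ≤ γ ^ t * ν (v 0) x := by
  intro t
  induction t with
  | zero => intro v σ _ x; simp [pathProd]
  | succ t ih =>
    intro v σ hp x
    rw [cjsrAux_pathProd_succ, ← Matrix.mulVec_mulVec]
    have h := ih (fun i => v i.succ) (fun i => σ i.succ) (fun i => hp i.succ)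
      ((A (σ 0)).mulVec x)
    have h0 := hν.2 _ _ _ (hp 0) x
    calc _ ≤ _ := h
      _ ≤ γ ^ t * (γ * ν (v 0) x) := mul_le_mul_of_nonneg_left h0 (by positivity)
      _ = _ := by ring

theorem cjsrAux_prod_bound {V : Type} [Fintype V] [Nonempty V] {n N : ℕ}
    {E : Set (V × V × Fin N)}
    {A : Fin N → Matrix (Fin n) (Fin n) ℝ} {γ : ℝ} (hγ : 0 < γ)
    {ν : V → (Fin n → ℝ) → ℝ} (hν : IsMultinorm E A γ ν) :
    ∃ D : ℝ, 0 < D ∧ ∀ (t : ℕ) (v : Fin (t + 1) → V) (σ : Fin t → Fin N), IsPath E v σ →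
      euclOpNorm (pathProd A t σ) ≤ D * γ ^ t := by
  choose C hC hC' using fun u => cjsrAux_equiv (ν u) (hν.1 u).1 (hν.1 u).2.1 (hν.1 u).2.2
  let K := ∑ u, C u
  have hK : ∀ u, C u ≤ K := fun u =>
    Finset.single_le_sum (f := C) (fun i _ => (hC i).le) (Finset.mem_univ u)
  have hK0 : 0 < K := (hC (Classical.arbitrary V)).trans_le (hK _)
  refine ⟨K * K, by positivity, fun t v σ hp => euclOpNorm_le_of _ _ (by positivity) fun x => ?_⟩
  have h := cjsrAux_path_le hγ hν t v σ hp x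
  set y := (pathProd A t σ).mulVec x
  have hy := (hC' (v (Fin.last t)) y).2
  have hx := (hC' (v 0) x).1
  have e0 := cjsrAuxE_nonneg x
  calc cjsrAuxE y ≤ _ := hy
    _ ≤ C (v (Fin.last t)) * (γ ^ t * (C (v 0) * cjsrAuxE x)) := by
        refine mul_le_mul_of_nonneg_left (h.trans ?_) (hC _).le
        exact mul_le_mul_of_nonneg_left hx (by positivity)
    _ ≤ K * (γ ^ t * (K * cjsrAuxE x)) := by
        have := (hC (v 0)).le
        gcongr
        · exact hK _
        · exact hK _
    _ = _ := by ring

/-- The sequence whose limsup is the CJSR. -/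
noncomputable def cjsrAuxS {V : Type} {n N : ℕ} (E : Set (V × V × Fin N))
    (A : Fin N → Matrix (Fin n) (Fin n) ℝ) (t : ℕ) : ℝ :=
  sSup { x : ℝ | ∃ (v : Fin (t + 1) → V) (σ : Fin t → Fin N),
      IsPath E v σ ∧ x = euclOpNorm (pathProd A t σ) ^ (1 / (t : ℝ)) }

theorem cjsrAuxS_nonneg {V : Type} {n N : ℕ} (E : Set (V × V × Fin N))
    (A : Fin N → Matrix (Fin n) (Fin n) ℝ) (t : ℕ) : 0 ≤ cjsrAuxS E A t := by
  apply Real.sSup_nonneg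
  rintro x ⟨v, σ, -, rfl⟩
  exact Real.rpow_nonneg (euclOpNorm_nonneg' _) _

theorem cjsrAuxS_ge {V : Type} [Fintype V] {n N : ℕ} (E : Set (V × V × Fin N))
    (A : Fin N → Matrix (Fin n) (Fin n) ℝ) (t : ℕ) (v : Fin (t + 1) → V) (σ : Fin t → Fin N)
    (hp : IsPath E v σ) :
    euclOpNorm (pathProd A t σ) ^ (1 / (t : ℝ)) ≤ cjsrAuxS E A t := by
  refine le_csSup ?_ ⟨v, σ, hp, rfl⟩
  apply Set.Finite.bddAbove
  apply (Set.finite_range (fun σ : Fin t → Fin N =>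
    euclOpNorm (pathProd A t σ) ^ (1 / (t : ℝ)))).subset
  rintro x ⟨v, σ, -, rfl⟩
  exact ⟨σ, rfl⟩

theorem cjsrAuxS_le {V : Type} {n N : ℕ} (E : Set (V × V × Fin N))
    (A : Fin N → Matrix (Fin n) (Fin n) ℝ) {γ D : ℝ} (hγ : 0 < γ) (hD : 0 < D)
    (h : ∀ (t : ℕ) (v : Fin (t + 1) → V) (σ : Fin t → Fin N), IsPath E v σ →
      euclOpNorm (pathProd A t σ) ≤ D * γ ^ t) (t : ℕ) (ht : 1 ≤ t) :
    cjsrAuxS E A t ≤ D ^ (1 / (t : ℝ)) * γ := by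
  apply Real.sSup_le _ (by positivity)
  rintro x ⟨v, σ, hp, rfl⟩
  have h1 := Real.rpow_le_rpow (euclOpNorm_nonneg' _) (h t v σ hp)
    (by positivity : 0 ≤ 1 / (t : ℝ))
  rw [Real.mul_rpow hD.le (by positivity)] at h1
  rwa [one_div, Real.pow_rpow_inv_natCast hγ.le (by omega), ← one_div] at h1

theorem cjsrAux_tendsto {D : ℝ} (hD : 0 < D) (γ : ℝ) :
    Tendsto (fun t : ℕ => D ^ (1 / (t : ℝ)) * γ) atTop (nhds γ) := by
  have h : Tendsto (fun t : ℕ => D ^ (1 / (t : ℝ))) atTop (nhds (D ^ (0 : ℝ))) :=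
    ((Real.continuousAt_const_rpow hD.ne').tendsto).comp
      (tendsto_one_div_atTop_nhds_zero_nat (𝕜 := ℝ))
  simpa using h.mul_const γ

theorem cjsrAux_initial {V : Type} {n N : ℕ} (E : Set (V × V × Fin N))
    (A : Fin N → Matrix (Fin n) (Fin n) ℝ) :
    ∃ γ : ℝ, 0 < γ ∧ ∃ ν : V → (Fin n → ℝ) → ℝ, IsMultinorm E A γ ν := by
  have hnn : 0 ≤ ∑ s, euclOpNorm (A s) := Finset.sum_nonneg fun i _ => euclOpNorm_nonneg' _
  refine ⟨1 + ∑ s, euclOpNorm (A s), by positivity, fun _ => cjsrAuxE,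
    fun _ => ⟨cjsrAuxE_add, cjsrAuxE_smul, cjsrAuxE_eq_zero⟩, fun _ _ s _ x => ?_⟩
  refine (cjsrAuxE_mulVec _ _).trans (mul_le_mul_of_nonneg_right ?_ (cjsrAuxE_nonneg _))
  have := Finset.single_le_sum (f := fun s => euclOpNorm (A s))
    (fun i _ => euclOpNorm_nonneg' _) (Finset.mem_univ s)
  linarith

/-- Paths starting at `u`. -/
def CjsrAuxP {V : Type} {N : ℕ} (E : Set (V × V × Fin N)) (u : V) : Type :=
  {p : Σ t : ℕ, (Fin (t + 1) → V) × (Fin t → Fin N) // IsPath E p.2.1 p.2.2 ∧ p.2.1 0 = u}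

theorem cjsrAux_construct {V : Type} {n N : ℕ} (E : Set (V × V × Fin N))
    (A : Fin N → Matrix (Fin n) (Fin n) ℝ) {γ K : ℝ} (hγ : 0 < γ)
    (h : ∀ (t : ℕ) (v : Fin (t + 1) → V) (σ : Fin t → Fin N), IsPath E v σ →
      euclOpNorm (pathProd A t σ) / γ ^ t ≤ K) :
    ∃ ν : V → (Fin n → ℝ) → ℝ, IsMultinorm E A γ ν := by
  let g : (u : V) → (Fin n → ℝ) → CjsrAuxP E u → ℝ := fun u x p =>
    cjsrAuxE ((pathProd A p.1.1 p.1.2.2).mulVec x) / γ ^ p.1.1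
  have hg0 : ∀ u x p, 0 ≤ g u x p := fun u x p => div_nonneg (cjsrAuxE_nonneg _) (by positivity)
  have hbdd : ∀ u x, BddAbove (Set.range (g u x)) := by
    intro u x
    refine ⟨K * cjsrAuxE x, ?_⟩
    rintro _ ⟨p, rfl⟩
    have h1 := h _ _ _ p.2.1
    have h2 := cjsrAuxE_mulVec (pathProd A p.1.1 p.1.2.2) x
    calc g u x p ≤ euclOpNorm (pathProd A p.1.1 p.1.2.2) * cjsrAuxE x / γ ^ p.1.1 :=
          div_le_div_of_nonneg_right h2 (by positivity)
      _ = euclOpNorm (pathProd A p.1.1 p.1.2.2) / γ ^ p.1.1 * cjsrAuxE x := by ring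
      _ ≤ _ := mul_le_mul_of_nonneg_right h1 (cjsrAuxE_nonneg _)
  let triv : (u : V) → CjsrAuxP E u := fun u =>
    ⟨⟨0, fun _ => u, fun i => i.elim0⟩, fun i => i.elim0, rfl⟩
  have hne : ∀ u, Nonempty (CjsrAuxP E u) := fun u => ⟨triv u⟩
  refine ⟨fun u x => ⨆ p, g u x p, fun u => ⟨fun x y => ?_, fun a x => ?_, fun x hx => ?_⟩,
    fun vi vj s he x => ?_⟩
  · refine ciSup_le fun p => ?_
    refine le_trans ?_ (add_le_add (le_ciSup (hbdd u x) p) (le_ciSup (hbdd u y) p))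
    simp only [g, Matrix.mulVec_add, ← add_div]
    exact div_le_div_of_nonneg_right (cjsrAuxE_add _ _) (by positivity)
  · simp only
    rw [Real.mul_iSup_of_nonneg (abs_nonneg a)]
    congr 1
    funext p
    simp only [g, Matrix.mulVec_smul, cjsrAuxE_smul, mul_div_assoc]
  · apply cjsrAuxE_eq_zero
    refine le_antisymm ?_ (cjsrAuxE_nonneg _)
    have h1 := le_ciSup (hbdd u x) (triv u)
    simp only at hx
    rw [hx] at h1
    simpa [g, triv, pathProd] using h1
  · refine ciSup_le fun p => ?_
    obtain ⟨⟨t, v, σ⟩, hp, hv⟩ := p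
    simp only at hp hv
    let q : CjsrAuxP E vi := ⟨⟨t + 1, Fin.cons vi v, Fin.cons s σ⟩, by
      refine ⟨fun i => ?_, rfl⟩
      refine Fin.cases ?_ (fun i => ?_) i
      · simpa [hv] using he
      · simpa using hp i⟩
    have h1 := mul_le_mul_of_nonneg_left (le_ciSup (hbdd vi x) q) hγ.le
    refine le_trans (le_of_eq ?_) h1
    simp only [g, q, cjsrAux_pathProd_succ, Fin.cons_succ, Fin.cons_zero, ← Matrix.mulVec_mulVec]
    field_simp
    ring

theorem cjsrAux_lt {V : Type} [Fintype V] {n N : ℕ} (E : Set (V × V × Fin N))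
    (A : Fin N → Matrix (Fin n) (Fin n) ℝ) {γ : ℝ} (hγ : 0 < γ)
    (h : ∀ᶠ t in atTop, cjsrAuxS E A t < γ) :
    ∃ ν : V → (Fin n → ℝ) → ℝ, IsMultinorm E A γ ν := by
  obtain ⟨T, hT⟩ := eventually_atTop.mp h
  let F : ℕ → ℝ := fun t => ∑ σ : Fin t → Fin N, euclOpNorm (pathProd A t σ) / γ ^ t
  have hf : ∀ t (σ : Fin t → Fin N), 0 ≤ euclOpNorm (pathProd A t σ) / γ ^ t := fun t σ =>
    div_nonneg (euclOpNorm_nonneg' _) (by positivity)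
  have hF : ∀ t, 0 ≤ F t := fun t => Finset.sum_nonneg fun σ _ => hf t σ
  have hS : 0 ≤ ∑ t ∈ Finset.range (T + 1), F t := Finset.sum_nonneg fun t _ => hF t
  refine cjsrAux_construct E A (K := 1 + ∑ t ∈ Finset.range (T + 1), F t) hγ fun t v σ hp => ?_
  by_cases ht : t < T + 1
  · have h1 : euclOpNorm (pathProd A t σ) / γ ^ t ≤ F t :=
      Finset.single_le_sum (f := fun σ : Fin t → Fin N => euclOpNorm (pathProd A t σ) / γ ^ t)
        (fun σ _ => hf t σ) (Finset.mem_univ σ)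
    have h2 : F t ≤ ∑ t ∈ Finset.range (T + 1), F t :=
      Finset.single_le_sum (f := F) (fun t _ => hF t) (Finset.mem_range.mpr ht)
    linarith
  · have h1 := (cjsrAuxS_ge E A t v σ hp).trans (hT t (by omega)).le
    have h2 := pow_le_pow_left₀ (Real.rpow_nonneg (euclOpNorm_nonneg' _) _) h1 t
    rw [one_div, Real.rpow_inv_natCast_pow (euclOpNorm_nonneg' _) (by omega)] at h2
    have : euclOpNorm (pathProd A t σ) / γ ^ t ≤ 1 := (div_le_one (by positivity)).mpr h2
    linarith

/-- `ρ̂(G, M)` is the infimum of the `γ > 0` admitting a `γ`-multinorm. -/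
theorem cjsr_eq_sInf_multinorm {n N : ℕ} (hn : 1 ≤ n) (hN : 1 ≤ N)
    {V : Type} [Fintype V] [Nonempty V]
    (E : Set (V × V × Fin N)) (A : Fin N → Matrix (Fin n) (Fin n) ℝ)
    (hconn : StronglyConnected E) :
    cjsr E A = sInf {γ : ℝ | 0 < γ ∧
      ∃ ν : V → (Fin n → ℝ) → ℝ, IsMultinorm E A γ ν} := by
  change limsup (cjsrAuxS E A) atTop = _
  have hev : ∀ γ : ℝ, 0 < γ → (∃ ν : V → (Fin n → ℝ) → ℝ, IsMultinorm E A γ ν) →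
      ∀ c, γ < c → ∀ᶠ t in atTop, cjsrAuxS E A t ≤ c := by
    rintro γ hγ ⟨ν, hν⟩ c hc
    obtain ⟨D, hD, hb⟩ := cjsrAux_prod_bound hγ hν
    filter_upwards [(cjsrAux_tendsto hD γ).eventually_lt_const hc, eventually_ge_atTop 1]
      with t h1 h2
    exact (cjsrAuxS_le E A hγ hD hb t h2).trans h1.le
  obtain ⟨γ₀, hγ₀, hν₀⟩ := cjsrAux_initial E A
  have hbd : IsBoundedUnder (· ≤ ·) atTop (cjsrAuxS E A) :=
    ⟨γ₀ + 1, hev γ₀ hγ₀ hν₀ _ (by linarith)⟩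
  have hbd' : IsBoundedUnder (· ≥ ·) atTop (cjsrAuxS E A) :=
    isBoundedUnder_of ⟨0, fun t => cjsrAuxS_nonneg E A t⟩
  have hcob : IsCoboundedUnder (· ≤ ·) atTop (cjsrAuxS E A) := hbd'.isCoboundedUnder_le
  apply le_antisymm
  · refine le_csInf ⟨γ₀, hγ₀, hν₀⟩ ?_
    rintro γ ⟨hγ, hν⟩
    refine le_of_forall_gt_imp_ge_of_dense fun c hc => ?_
    exact limsup_le_of_le hcob (hev γ hγ hν c hc)
  · refine le_of_forall_gt_imp_ge_of_dense fun γ hγ => ?_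
    have h0 : 0 ≤ limsup (cjsrAuxS E A) atTop :=
      le_limsup_of_frequently_le
        (Eventually.of_forall fun t => cjsrAuxS_nonneg E A t).frequently hbd
    have hpos : 0 < γ := h0.trans_lt hγ
    exact csInf_le ⟨0, fun x hx => hx.1.le⟩
      ⟨hpos, cjsrAux_lt E A hpos (eventually_lt_of_limsup_lt hγ hbd)⟩
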